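/- Every $\beta$-acyclic hypergraph with at least one node has a $\beta$-leaf, and removing any node from a $\beta$-acyclic hypergraph yields a $\beta$-acyclic hypergraph. -/

import Mathlib

open Finset

variable {V : Type*} [DecidableEq V]

/-- Removal of a node from a hypergraph edge set: erase `v` from every edge and keep the
nonempty results. -/
def eraseNodeE (E : Finset (Finset V)) (v : V) : Finset (Finset V) :=
  (E.image fun e => e.erase v).filter fun e => e.Nonempty

/-- `v` is a β-leaf: the edges containing `v` are totally ordered by inclusion. -/
def BetaLeaf (E : Finset (Finset V)) (v : V) : Prop :=
  ∀ e ∈ E, ∀ f ∈ E, v ∈ e → v ∈ f → e ⊆ f ∨ f ⊆ e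

/-- `E` contains a β-cycle: distinct nodes `v₁, …, v_q` and distinct edges `e₁, …, e_q`
(`q ≥ 3`) with `vᵢ ∈ e_{i-1} ∩ eᵢ` (cyclically) and `vᵢ` in no other edge of the cycle. -/
def HasBetaCycle (E : Finset (Finset V)) : Prop :=
  ∃ (q : ℕ) (hq : 3 ≤ q) (vs : Fin q → V) (es : Fin q → Finset V),
    Function.Injective vs ∧ Function.Injective es ∧ (∀ i, es i ∈ E) ∧
    ∀ i : Fin q, vs i ∈ es (i - ⟨1, by omega⟩) ∧ vs i ∈ es i ∧
      ∀ j, j ≠ i - ⟨1, by omega⟩ → j ≠ i → vs i ∉ es j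

/-- The columns of `M` are weakly increasing in the lexicographic order that compares entries from
the last row upwards. -/
def LexColumns {R C : Type*} [LT R] [LT C] (M : R → C → Prop) : Prop :=
  ∀ c c', c < c' → ∀ r, M r c → ¬ M r c' →
    ∃ r', r < r' ∧ ¬ M r' c ∧ M r' c' ∧ ∀ s, r' < s → (M s c ↔ M s c')

open Classical in
/-- The number whose binary digits are given by `P`. -/
noncomputable def binaryValue {m : ℕ} (P : Fin m → Prop) : ℕ :=
  ∑ i, if P i then 2 ^ (i : ℕ) else 0

lemma exists_last_difference {m : ℕ} {P Q : Fin m → Prop}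
    (h : binaryValue P ≤ binaryValue Q) {i : Fin m} (hP : P i) (hQ : ¬ Q i) :
    ∃ j, i < j ∧ ¬ P j ∧ Q j ∧ ∀ k, j < k → (P k ↔ Q k) := by
  classical
  have key : ∀ P : Fin m → Prop,
      binaryValue P = ∑ k ∈ (univ.filter P).map Fin.valEmbedding, 2 ^ k := by
    intro P
    simp [binaryValue, Finset.sum_filter]
  rw [key, key, geomSum_le_geomSum_iff_toColex_le_toColex le_rfl, Colex.toColex_le_toColex] at h
  obtain ⟨j, hj, hmax⟩ := (univ.filter fun k => ¬ (P k ↔ Q k)).exists_max_image id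
    ⟨i, by simp [hP, hQ]⟩
  simp only [mem_filter, mem_univ, true_and, id_eq] at hj hmax
  have hjP : ¬ P j := by
    intro hPj
    have hQj : ¬ Q j := by tauto
    obtain ⟨b, hb, hb', hle⟩ := h (a := j) (by simpa [Fin.val_inj] using hPj)
      (by simpa [Fin.val_inj] using hQj)
    simp only [mem_map, mem_filter, mem_univ, true_and, Fin.valEmbedding_apply] at hb hb'
    obtain ⟨b, hQb, rfl⟩ := hb
    have hPb : ¬ P b := fun hPb => hb' ⟨b, hPb, rfl⟩
    have : b = j := le_antisymm (hmax b (by tauto)) hle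
    exact hQj (this ▸ hQb)
  refine ⟨j, lt_of_le_of_ne (hmax i (by tauto)) ?_, hjP, by tauto, fun k hk => ?_⟩
  · rintro rfl
    exact hjP hP
  · by_contra hne
    exact absurd (hmax k hne) (not_le.2 hk)

lemma monotone_of_sum_mul_comp_perm_le {n : ℕ} {w K : Fin n → ℕ} (hw : StrictMono w)
    (h : ∀ π : Equiv.Perm (Fin n), ∑ j, w j * K (π j) ≤ ∑ j, w j * K j) : Monotone K := by
  have hmono : Monovary w (K ∘ Tuple.sort K) :=
    hw.monotone.monovary (Tuple.monotone_sort K)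
  have := hmono.sum_mul_comp_perm_lt_sum_mul_iff (σ := (Tuple.sort K)⁻¹)
  have hK : (K ∘ Tuple.sort K) ∘ ((Tuple.sort K)⁻¹ : Equiv.Perm (Fin n)) = K := by
    ext; simp
  rw [hK] at this
  have hwK : Monovary w K := by
    by_contra hne
    refine absurd (h (Tuple.sort K)) (not_le.2 ?_)
    simpa using this.2 hne
  intro i j hij
  by_contra hlt
  have hle := hwK (not_le.1 hlt)
  rcases hij.eq_or_lt with rfl | hij
  · exact hlt le_rfl
  · exact absurd (hw hij) (not_lt.2 hle)

/-- Rows and columns of a finite relation can be ordered doubly lexically. -/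
lemma exists_doubly_lexical {R C : Type*} [Fintype R] [Fintype C] (M : R → C → Prop) :
    ∃ (σ : Fin (Fintype.card R) ≃ R) (τ : Fin (Fintype.card C) ≃ C),
      LexColumns (fun i j => M (σ i) (τ j)) ∧ LexColumns (fun j i => M (σ i) (τ j)) := by
  classical
  let Φ : (Fin (Fintype.card R) ≃ R) × (Fin (Fintype.card C) ≃ C) → ℕ := fun p =>
    ∑ j : Fin (Fintype.card C), 2 ^ (j : ℕ) * binaryValue fun i => M (p.1 i) (p.2 j)
  have hΦ : ∀ p, Φ p =
      ∑ i : Fin (Fintype.card R), 2 ^ (i : ℕ) * binaryValue fun j => M (p.1 i) (p.2 j) := by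
    intro p
    simp only [Φ, binaryValue, Finset.mul_sum]
    rw [Finset.sum_comm]
    refine Finset.sum_congr rfl fun i _ => Finset.sum_congr rfl fun j _ => ?_
    split_ifs <;> ring
  have hpow : ∀ n, StrictMono fun i : Fin n => 2 ^ (i : ℕ) := fun n i j hij =>
    Nat.pow_lt_pow_right (by norm_num) hij
  obtain ⟨⟨σ, τ⟩, -, hmax⟩ := (univ : Finset ((Fin (Fintype.card R) ≃ R) ×
    (Fin (Fintype.card C) ≃ C))).exists_max_image Φ
    ⟨((Fintype.equivFin R).symm, (Fintype.equivFin C).symm), mem_univ _⟩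
  refine ⟨σ, τ, fun c c' hc r h h' => ?_, fun c c' hc r h h' => ?_⟩
  · have := monotone_of_sum_mul_comp_perm_le (hpow _)
      (K := fun j => binaryValue fun i => M (σ i) (τ j))
      fun π => hmax (σ, π.trans τ) (mem_univ _)
    exact exists_last_difference (this hc.le) h h'
  · have := monotone_of_sum_mul_comp_perm_le (hpow _)
      (K := fun i => binaryValue fun j => M (σ i) (τ j)) fun π => by
        have := hmax (π.trans σ, τ) (mem_univ _)
        rwa [hΦ, hΦ] at this
    exact exists_last_difference (this hc.le) h h'

/-- The rows `r 1, …, r k` and columns `c 1, …, c k` form an increasing induced path of `M` with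
ends `r k` and `c k` (apart from the entry at `(r k, c k)`, which is unconstrained), and the
columns `c j`, `c (j + 1)` agree below the row `r (j + 2)`, as do rows symmetrically. -/
structure IsLexPath {R C : Type*} [LT R] [LT C] (M : R → C → Prop) (k : ℕ)
    (r : ℕ → R) (c : ℕ → C) : Prop where
  row_lt : ∀ i j, 1 ≤ i → i < j → j ≤ k → r i < r j
  col_lt : ∀ i j, 1 ≤ i → i < j → j ≤ k → c i < c j
  incidence : ∀ i j, 1 ≤ i → i ≤ k → 1 ≤ j → j ≤ k → (i ≠ k ∨ j ≠ k) →
    (M (r i) (c j) ↔ (i = 1 ∧ j = 1) ∨ i = j + 1 ∨ j = i + 1)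
  col_agree : ∀ j, 1 ≤ j → j + 2 ≤ k → ∀ s, r (j + 2) < s → (M s (c j) ↔ M s (c (j + 1)))
  row_agree : ∀ i, 1 ≤ i → i + 2 ≤ k → ∀ s, c (i + 2) < s → (M (r i) s ↔ M (r (i + 1)) s)

/-- Extending a path by one row `x` that meets only the last column, one half of the step. -/
lemma IsLexPath.exists_next_row {R C : Type*} [Preorder R] [Preorder C] {M : R → C → Prop} {k : ℕ}
    {r : ℕ → R} {c : ℕ → C} (h : IsLexPath M k r c) (hk : 2 ≤ k) (hM : LexColumns M)
    (hend : ¬ M (r k) (c k)) :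
    ∃ x, r k < x ∧ (∀ j, 1 ≤ j → j ≤ k → (M x (c j) ↔ j = k)) ∧
      ∀ s, x < s → (M s (c (k - 1)) ↔ M s (c k)) := by
  obtain ⟨x, hx, h0, h1, hagree⟩ := hM (c (k - 1)) (c k)
    (h.col_lt _ _ (by omega) (by omega) le_rfl) (r k)
    ((h.incidence k (k - 1) (by omega) le_rfl (by omega) (by omega) (by omega)).2 (by omega)) hend
  have hzero : ∀ d, d + 1 < k → ¬ M x (c (k - 1 - d)) := by
    intro d
    induction d with
    | zero => exact fun _ => h0
    | succ d ih =>
      intro hd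
      have hlt : r (k - 1 - (d + 1) + 2) < x := by
        rcases Nat.eq_zero_or_pos d with rfl | hd'
        · rwa [show k - 1 - (0 + 1) + 2 = k by omega]
        · exact (h.row_lt _ k (by omega) (by omega) le_rfl).trans hx
      rw [h.col_agree (k - 1 - (d + 1)) (by omega) (by omega) x hlt,
        show k - 1 - (d + 1) + 1 = k - 1 - d by omega]
      exact ih (by omega)
  refine ⟨x, hx, fun j hj hjk => ⟨fun hxj => ?_, fun hj => hj ▸ h1⟩, hagree⟩
  by_contra hne
  refine hzero (k - 1 - j) (by omega) ?_
  rwa [show k - 1 - (k - 1 - j) = j by omega]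

lemma IsLexPath.swap {R C : Type*} [LT R] [LT C] {M : R → C → Prop} {k : ℕ}
    {r : ℕ → R} {c : ℕ → C} (h : IsLexPath M k r c) : IsLexPath (fun x y => M y x) k c r where
  row_lt := h.col_lt
  col_lt := h.row_lt
  incidence i j hi hik hj hjk hne := by
    rw [h.incidence j i hj hjk hi hik hne.symm]
    omega
  col_agree := h.row_agree
  row_agree := h.col_agree

lemma IsLexPath.exists_succ {R C : Type*} [Preorder R] [Preorder C] {M : R → C → Prop} {k : ℕ}
    {r : ℕ → R} {c : ℕ → C} (h : IsLexPath M k r c) (hk : 2 ≤ k) (hM : LexColumns M)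
    (hM' : LexColumns fun c r => M r c) (hend : ¬ M (r k) (c k)) :
    ∃ r' c', IsLexPath M (k + 1) r' c' := by
  obtain ⟨x, hx, hxc, hxa⟩ := h.exists_next_row hk hM hend
  obtain ⟨y, hy, hyr, hya⟩ := h.swap.exists_next_row hk hM' hend
  refine ⟨fun i => if i ≤ k then r i else x, fun i => if i ≤ k then c i else y,
    ?_, ?_, ?_, ?_, ?_⟩
  · intro i j hi hij hj
    rcases Nat.lt_or_ge k j with hjk | hjk
    · rw [if_pos (by omega), if_neg (by omega)]
      rcases (show i ≤ k by omega).eq_or_lt with rfl | hik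
      · exact hx
      · exact (h.row_lt i k hi hik le_rfl).trans hx
    · rw [if_pos (by omega), if_pos hjk]
      exact h.row_lt i j hi hij hjk
  · intro i j hi hij hj
    rcases Nat.lt_or_ge k j with hjk | hjk
    · rw [if_pos (by omega), if_neg (by omega)]
      rcases (show i ≤ k by omega).eq_or_lt with rfl | hik
      · exact hy
      · exact (h.col_lt i k hi hik le_rfl).trans hy
    · rw [if_pos (by omega), if_pos hjk]
      exact h.col_lt i j hi hij hjk
  · intro i j hi hik hj hjk hne
    rcases Nat.lt_or_ge k i with hi' | hi' <;> rcases Nat.lt_or_ge k j with hj' | hj'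
    · omega
    · rw [if_neg (by omega), if_pos hj', hxc j hj hj']
      omega
    · rw [if_pos hi', if_neg (by omega), hyr i hi hi']
      omega
    · rw [if_pos hi', if_pos hj']
      by_cases hkk : i = k ∧ j = k
      · obtain ⟨rfl, rfl⟩ := hkk
        simp only [hend, false_iff]
        omega
      · exact h.incidence i j hi hi' hj hj' (by omega)
  · intro j hj hjk s
    rw [if_pos (show j ≤ k by omega), if_pos (show j + 1 ≤ k by omega)]
    split_ifs with hle
    · exact h.col_agree j hj hle s
    · have := hxa s
      rwa [show k = j + 1 by omega] at this
  · intro j hj hjk s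
    rw [if_pos (show j ≤ k by omega), if_pos (show j + 1 ≤ k by omega)]
    split_ifs with hle
    · exact h.row_agree j hj hle s
    · have := hya s
      rwa [show k = j + 1 by omega] at this

/-- In a finite doubly lexical relation, a `Γ` (rows `r₁ < r₂`, columns `c₁ < c₂`, with the single
non-incidence `(r₂, c₂)`) extends to a path whose ends are incident. -/
lemma exists_closed_lexPath {R C : Type*} [Preorder R] [Preorder C] [Finite R] {M : R → C → Prop}
    (hM : LexColumns M) (hM' : LexColumns fun c r => M r c) {r₁ r₂ : R} {c₁ c₂ : C}
    (hr : r₁ < r₂) (hc : c₁ < c₂) (h11 : M r₁ c₁) (h12 : M r₁ c₂) (h21 : M r₂ c₁)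
    (h22 : ¬ M r₂ c₂) :
    ∃ k r c, 3 ≤ k ∧ IsLexPath M k r c ∧ M (r k) (c k) := by
  by_contra! hno
  have hall : ∀ k, ∃ r c, IsLexPath M (k + 2) r c ∧ ¬ M (r (k + 2)) (c (k + 2)) := by
    intro k
    induction k with
    | zero =>
      refine ⟨fun i => if i = 1 then r₁ else r₂, fun i => if i = 1 then c₁ else c₂,
        ⟨?_, ?_, ?_, ?_, ?_⟩, by simpa using h22⟩
      · intro i j hi hij hj
        obtain rfl : i = 1 := by omega
        obtain rfl : j = 2 := by omega
        simpa using hr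
      · intro i j hi hij hj
        obtain rfl : i = 1 := by omega
        obtain rfl : j = 2 := by omega
        simpa using hc
      · intro i j hi hik hj hjk hne
        obtain rfl | rfl : i = 1 ∨ i = 2 := by omega
        all_goals obtain rfl | rfl : j = 1 ∨ j = 2 := by omega
        all_goals simp_all
      · intros
        omega
      · intros
        omega
    | succ k ih =>
      obtain ⟨r, c, h, hend⟩ := ih
      obtain ⟨r', c', h'⟩ := h.exists_succ (by omega) hM hM' hend
      exact ⟨r', c', h', hno _ _ _ (by omega) h'⟩
  obtain ⟨r, c, h, -⟩ := hall (Nat.card R)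
  have hmono : StrictMono fun i : Fin (Nat.card R + 1) => r (i + 1) := fun i j hij =>
    h.row_lt _ _ (by omega) (Nat.succ_lt_succ hij) (by omega)
  have hinj : Function.Injective fun i : Fin (Nat.card R + 1) => r (i + 1) := hmono.injective
  have := Nat.card_le_card_of_injective _ hinj
  simp at this

lemma Fin.val_sub_one_mk {q : ℕ} (hq : 1 < q) (i : Fin q) :
    (i - ⟨1, hq⟩ : Fin q).val = if i.val = 0 then q - 1 else i.val - 1 := by
  rw [Fin.sub_def]
  have := i.isLt
  split_ifs with h
  · simp [h, Nat.mod_eq_of_lt (show q - 1 < q by omega)]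
  · simp only
    rw [show q - 1 + i.val = (i.val - 1) + q by omega, Nat.add_mod_right,
      Nat.mod_eq_of_lt (by omega)]

/-- A closed path in the incidence relation of a hypergraph is a β-cycle: traverse the rows
`1, 3, 5, …, 6, 4, 2` and the columns `1, 2, 4, …, 5, 3`. -/
lemma hasBetaCycle_of_isLexPath {V R C : Type*} [Preorder R] [Preorder C]
    {E : Finset (Finset V)} {edge : R → Finset V} {node : C → V} (hedge : Function.Injective edge)
    (hnode : Function.Injective node) (hE : ∀ x, edge x ∈ E) {k : ℕ} {r : ℕ → R} {c : ℕ → C}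
    (hk : 3 ≤ k) (h : IsLexPath (fun x y => node y ∈ edge x) k r c)
    (hend : node (c k) ∈ edge (r k)) : HasBetaCycle E := by
  have hrinj : ∀ i j, 1 ≤ i → i ≤ k → 1 ≤ j → j ≤ k → r i = r j → i = j := by
    intro i j hi hik hj hjk hij
    rcases lt_trichotomy i j with hlt | rfl | hlt
    · exact absurd hij (h.row_lt i j hi hlt hjk).ne
    · rfl
    · exact absurd hij.symm (h.row_lt j i hj hlt hik).ne
  have hcinj : ∀ i j, 1 ≤ i → i ≤ k → 1 ≤ j → j ≤ k → c i = c j → i = j := by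
    intro i j hi hik hj hjk hij
    rcases lt_trichotomy i j with hlt | rfl | hlt
    · exact absurd hij (h.col_lt i j hi hlt hjk).ne
    · rfl
    · exact absurd hij.symm (h.col_lt j i hj hlt hik).ne
  have hinc : ∀ i j, 1 ≤ i → i ≤ k → 1 ≤ j → j ≤ k → (node (c j) ∈ edge (r i) ↔
      (i = 1 ∧ j = 1) ∨ (i = k ∧ j = k) ∨ i = j + 1 ∨ j = i + 1) := by
    intro i j hi hik hj hjk
    by_cases hkk : i = k ∧ j = k
    · obtain ⟨rfl, rfl⟩ := hkk
      simpa using hend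
    · rw [h.incidence i j hi hik hj hjk (by omega)]
      omega
  let ρ : ℕ → ℕ := fun i => if 2 * i + 1 ≤ k then 2 * i + 1 else 2 * (k - i)
  let γ : ℕ → ℕ := fun i =>
    if i = 0 then 1 else if 2 * i ≤ k then 2 * i else 2 * (k - i) + 1
  have hρ : ∀ i < k, 1 ≤ ρ i ∧ ρ i ≤ k := by
    intro i hi
    simp only [ρ]
    split_ifs <;> omega
  have hγ : ∀ i < k, 1 ≤ γ i ∧ γ i ≤ k := by
    intro i hi
    simp only [γ]
    split_ifs <;> omega
  refine ⟨k, hk, fun i => node (c (γ i)), fun i => edge (r (ρ i)), ?_, ?_, fun i => hE _, ?_⟩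
  · intro i j hij
    have hi := hγ i i.isLt
    have hj := hγ j j.isLt
    have heq := hcinj _ _ hi.1 hi.2 hj.1 hj.2 (hnode hij)
    have hik := i.isLt
    have hjk := j.isLt
    ext
    simp only [γ] at heq
    split_ifs at heq <;> omega
  · intro i j hij
    have hi := hρ i i.isLt
    have hj := hρ j j.isLt
    have heq := hrinj _ _ hi.1 hi.2 hj.1 hj.2 (hedge hij)
    have hik := i.isLt
    have hjk := j.isLt
    ext
    simp only [ρ] at heq
    split_ifs at heq <;> omega
  · intro i
    have hi := hγ i i.isLt
    have hik := i.isLt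
    have hmem : ∀ j : Fin k, node (c (γ i)) ∈ edge (r (ρ j)) ↔
        j = i - ⟨1, by omega⟩ ∨ j = i := by
      intro j
      have hj := hρ j j.isLt
      have hjk := j.isLt
      rw [hinc _ _ hj.1 hj.2 hi.1 hi.2, Fin.ext_iff, Fin.ext_iff, Fin.val_sub_one_mk]
      simp only [ρ, γ]
      split_ifs <;> omega
    refine ⟨(hmem _).2 (.inl rfl), (hmem _).2 (.inr rfl), fun j h₁ h₂ hj => ?_⟩
    exact ((hmem j).1 hj).elim h₁ h₂

theorem exists_betaLeaf_of_not_hasBetaCycle [Finite V] [Nonempty V] {E : Finset (Finset V)}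
    (hE : ¬ HasBetaCycle E) : ∃ v : V, BetaLeaf E v := by
  have := Fintype.ofFinite V
  obtain ⟨σ, τ, hM, hM'⟩ := exists_doubly_lexical fun (e : E) (v : V) => v ∈ e.1
  have hpos : 0 < Fintype.card V := Fintype.card_pos
  have hsub : ∀ i j, i < j → τ ⟨0, hpos⟩ ∈ (σ i).1 → τ ⟨0, hpos⟩ ∈ (σ j).1 →
      (σ i).1 ⊆ (σ j).1 := by
    intro i j hij hi hj v hv
    by_contra hv'
    obtain ⟨w, rfl⟩ := τ.surjective v
    have hw : (⟨0, hpos⟩ : Fin _) < w := by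
      refine lt_of_le_of_ne (Nat.zero_le _) ?_
      rintro rfl
      exact hv' hj
    obtain ⟨k, r, c, hk, h, hend⟩ := exists_closed_lexPath hM hM' hij hw hi hv hj hv'
    exact hE (hasBetaCycle_of_isLexPath (Subtype.val_injective.comp σ.injective) τ.injective
      (fun x => (σ x).2) hk h hend)
  refine ⟨τ ⟨0, hpos⟩, fun e he f hf hve hvf => ?_⟩
  obtain ⟨i, hi⟩ := σ.surjective ⟨e, he⟩
  obtain ⟨j, hj⟩ := σ.surjective ⟨f, hf⟩
  obtain rfl : (σ i).1 = e := congrArg Subtype.val hi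
  obtain rfl : (σ j).1 = f := congrArg Subtype.val hj
  rcases lt_trichotomy i j with hlt | rfl | hlt
  · exact .inl (hsub i j hlt hve hvf)
  · exact .inl subset_rfl
  · exact .inr (hsub j i hlt hvf hve)

theorem HasBetaCycle.of_eraseNodeE {E : Finset (Finset V)} {v : V}
    (h : HasBetaCycle (eraseNodeE E v)) : HasBetaCycle E := by
  obtain ⟨q, hq, vs, es, hvs, hes, hmem, hcyc⟩ := h
  have hlift : ∀ i, ∃ e ∈ E, e.erase v = es i := fun i => by
    simpa using (mem_filter.1 (hmem i)).1
  choose f hf hfe using hlift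
  have hiff : ∀ i j, vs i ∈ f j ↔ vs i ∈ es j := by
    intro i j
    have hne : vs i ≠ v := by
      have := (hcyc i).2.1
      rw [← hfe] at this
      exact ne_of_mem_erase this
    rw [← hfe, mem_erase, and_iff_right hne]
  refine ⟨q, hq, vs, f, hvs, fun i j hij => hes ?_, hf, fun i => ?_⟩
  · rw [← hfe, ← hfe, hij]
  · simpa only [hiff] using hcyc i

/-- Using the characterization of β-acyclicity as the absence of β-cycles:
every β-acyclic hypergraph with at least one node has a β-leaf, and removing any node from a
β-acyclic hypergraph yields a β-acyclic hypergraph. -/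
theorem stmt_14 [Fintype V] (E : Finset (Finset V)) (hE : ∀ e ∈ E, 2 ≤ e.card)
    (hacyc : ¬ HasBetaCycle E) :
    (Nonempty V → ∃ v : V, BetaLeaf E v) ∧
    ∀ v : V, ¬ HasBetaCycle (eraseNodeE E v) := by
  exact ⟨fun _ => exists_betaLeaf_of_not_hasBetaCycle hacyc,
    fun _ h => hacyc h.of_eraseNodeE⟩
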